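/- The τ → 0 side of the modular-duality limit identity for ratios of odd Jacobi theta functions: Let g ≥ 1, let z_1, …, z_g ∈ (0,1) and a_1, b_1, …, a_g, b_g ∈ ℝ, and let i = √−1. Then lim_{y→0⁺} exp(2πi ∑_{j=1}^g (a_j − b_j) z_j) · ∏_{j=1}^g ϑ(z_j + i y a_j ; e^{−2πy}) / ϑ(z_j + i y b_j ; e^{−2πy}) = exp(πi ∑_{j=1}^g (a_j − b_j)). (With τ = iy and nome e^{2πiτ} = e^{−2πy}, this is the left-hand side of the limit identity used to identify the transport Trans(s) of the Dubrovin connection with the p → 0 limit of the connection matrix.) -/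

import Mathlib

open Complex

/-- The odd Jacobi theta function in additive variables:
`ϑ(x; q) = (e^{πix} − e^{−πix}) ∏_{n≥1} (1 − qⁿe^{2πix})(1 − qⁿe^{−2πix})`. -/
noncomputable def oddJacobiTheta (x : ℂ) (q : ℂ) : ℂ :=
  (Complex.exp (Real.pi * Complex.I * x) - Complex.exp (-(Real.pi * Complex.I * x))) *
    ∏' n : ℕ, ((1 - q ^ (n + 1) * Complex.exp (2 * Real.pi * Complex.I * x)) *
      (1 - q ^ (n + 1) * Complex.exp (-(2 * Real.pi * Complex.I * x))))

noncomputable def thE (t : ℝ) : ℂ := ((Real.exp (-(2 * Real.pi * t)) : ℝ) : ℂ)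

noncomputable def thL (w : ℂ) (t : ℝ) : ℂ := Complex.log (1 - w * thE t)

lemma thE_hasDeriv (t : ℝ) : HasDerivAt thE (-(2 * Real.pi) * thE t) t := by
  have h : HasDerivAt (fun t : ℝ => Real.exp (-(2 * Real.pi * t)))
      (Real.exp (-(2 * Real.pi * t)) * (-(2 * Real.pi * 1))) t :=
    (((hasDerivAt_id t).const_mul (2 * Real.pi)).neg).exp
  refine HasDerivAt.congr_deriv (f := thE) h.ofReal_comp ?_
  simp only [thE]
  push_cast
  ring

lemma th_normSq (w : ℂ) (hw : ‖w‖ = 1) (r : ℝ) (hr : 0 ≤ r) :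
    (1 - w.re) / 2 ≤ ‖1 - w * (r : ℂ)‖ ^ 2 := by
  have h1 : w.re * w.re + w.im * w.im = 1 := by
    rw [← Complex.normSq_apply, Complex.normSq_eq_norm_sq, hw]; norm_num
  rw [← Complex.normSq_eq_norm_sq, Complex.normSq_apply]
  simp
  have hc1 : w.re ≤ 1 := by nlinarith [sq_nonneg w.im]
  have hc2 : -1 ≤ w.re := by nlinarith [sq_nonneg w.im]
  have e : (1 - w.re * r) * (1 - w.re * r) + w.im * r * (w.im * r)
      = (1 - w.re) / 2 * (1 + r) ^ 2 + (1 + w.re) / 2 * (1 - r) ^ 2 := by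
    linear_combination r ^ 2 * h1
  rw [e]
  have : 0 ≤ (1 + w.re) / 2 * (1 - r) ^ 2 :=
    mul_nonneg (by linarith) (sq_nonneg _)
  have : (0:ℝ) ≤ (1 - w.re) / 2 * (2 * r + r ^ 2) :=
    mul_nonneg (by linarith) (by positivity)
  nlinarith

lemma th_re_lt (w : ℂ) (hw : ‖w‖ = 1) (hw1 : w ≠ 1) : w.re < 1 := by
  have h1 : w.re * w.re + w.im * w.im = 1 := by
    rw [← Complex.normSq_apply, Complex.normSq_eq_norm_sq, hw]; norm_num
  have hc1 : w.re ≤ 1 := by nlinarith [sq_nonneg w.im]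
  rcases hc1.lt_or_eq with h | h
  · exact h
  · exfalso; apply hw1
    apply Complex.ext
    · simpa using h
    · rw [h] at h1
      have : w.im * w.im = 0 := by linarith
      simpa using this

lemma th_slit (w : ℂ) (hw : ‖w‖ = 1) (hw1 : w ≠ 1) (t : ℝ) :
    1 - w * thE t ∈ Complex.slitPlane := by
  have h1 : w.re * w.re + w.im * w.im = 1 := by
    rw [← Complex.normSq_apply, Complex.normSq_eq_norm_sq, hw]; norm_num
  have hre := th_re_lt w hw hw1
  have hp := Real.exp_pos (-(2 * Real.pi * t))
  rw [Complex.mem_slitPlane_iff]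
  by_cases him : w.im = 0
  · left
    rw [him] at h1
    have : w.re = -1 := by
      have : (w.re - 1) * (w.re + 1) = 0 := by linarith
      rcases mul_eq_zero.1 this with h | h <;> linarith
    simp only [thE, Complex.sub_re, Complex.one_re, Complex.re_mul_ofReal]
    rw [this]; linarith
  · right
    simp only [thE, Complex.sub_im, Complex.one_im, Complex.im_mul_ofReal]
    have := mul_ne_zero him hp.ne'
    intro h; apply this; linarith

lemma thL_hasDeriv (w : ℂ) (hw : ‖w‖ = 1) (hw1 : w ≠ 1) (t : ℝ) :
    HasDerivAt (thL w) (2 * Real.pi * (w * thE t) / (1 - w * thE t)) t := by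
  have h : HasDerivAt (fun t : ℝ => 1 - w * thE t) (-(w * (-(2 * Real.pi) * thE t))) t :=
    ((thE_hasDeriv t).const_mul w).const_sub 1
  have := h.clog_real (th_slit w hw hw1 t)
  refine HasDerivAt.congr_deriv (f := thL w) this ?_
  ring

lemma thL_hasDeriv2 (w : ℂ) (hw : ‖w‖ = 1) (hw1 : w ≠ 1) (t : ℝ) :
    HasDerivAt (fun t : ℝ => 2 * Real.pi * (w * thE t) / (1 - w * thE t))
      (-(2 * Real.pi) ^ 2 * (w * thE t) / (1 - w * thE t) ^ 2) t := by
  have h0 := (thE_hasDeriv t).const_mul w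
  have h : HasDerivAt (fun t : ℝ => 1 - w * thE t) (-(w * (-(2 * Real.pi) * thE t))) t :=
    h0.const_sub 1
  have hne := Complex.slitPlane_ne_zero (th_slit w hw hw1 t)
  have := (h0.const_mul (2 * Real.pi : ℂ)).div h hne
  refine HasDerivAt.congr_deriv
    (f := fun t : ℝ => 2 * Real.pi * (w * thE t) / (1 - w * thE t)) this ?_
  congr 1
  ring

lemma thL_bound2 (w : ℂ) (hw : ‖w‖ = 1) (hw1 : w ≠ 1) (t : ℝ) :
    ‖-(2 * Real.pi : ℂ) ^ 2 * (w * thE t) / (1 - w * thE t) ^ 2‖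
      ≤ ((2 * Real.pi) ^ 2 / ((1 - w.re) / 2)) * Real.exp (-(2 * Real.pi * t)) := by
  have hre := th_re_lt w hw hw1
  have hp := Real.exp_pos (-(2 * Real.pi * t))
  have hb := th_normSq w hw _ hp.le
  have hn : ‖thE t‖ = Real.exp (-(2 * Real.pi * t)) := by
    simp only [thE]; rw [Complex.norm_real, Real.norm_of_nonneg hp.le]
  rw [norm_div, norm_mul, norm_neg, norm_mul, hw, hn, norm_pow, norm_pow]
  have h2 : ‖(2 * Real.pi : ℂ)‖ = 2 * Real.pi := by
    simp [abs_of_pos Real.pi_pos]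
  rw [h2, one_mul, mul_div_right_comm]
  apply mul_le_mul_of_nonneg_right _ hp.le
  apply div_le_div_of_nonneg_left (by positivity) (by linarith) hb

/-- Taylor estimate. -/
lemma th_taylor (f fd fdd : ℝ → ℂ) (h1 : ∀ t, HasDerivAt f (fd t) t)
    (h2 : ∀ t, HasDerivAt fd (fdd t) t) (t r M : ℝ) (hM : 0 ≤ M)
    (hb : ∀ s, |s - t| ≤ r → ‖fdd s‖ ≤ M) (s : ℝ) (hs : |s - t| ≤ r) :
    ‖f s - f t - (s - t : ℝ) * fd t‖ ≤ M * r ^ 2 := by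
  have hr : 0 ≤ r := (abs_nonneg _).trans hs
  have hconv : Convex ℝ (Metric.closedBall t r) := convex_closedBall t r
  have ht : t ∈ Metric.closedBall t r := Metric.mem_closedBall_self hr
  have hmem : ∀ s, s ∈ Metric.closedBall t r ↔ |s - t| ≤ r := by
    intro s; rw [Metric.mem_closedBall, Real.dist_eq]
  have hA : ∀ s ∈ Metric.closedBall t r, ‖fd s - fd t‖ ≤ M * r := by
    intro s hs
    have := hconv.norm_image_sub_le_of_norm_hasDerivWithin_le
      (fun x _ => (h2 x).hasDerivWithinAt) (fun x hx => hb x ((hmem x).1 hx)) ht hs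
    refine this.trans (mul_le_mul_of_nonneg_left ?_ hM)
    simpa using (hmem s).1 hs
  have hD : ∀ x : ℝ, HasDerivAt (fun x : ℝ => f x - ((x - t : ℝ) : ℂ) * fd t) (fd x - fd t) x := by
    intro x
    have h3 : HasDerivAt (fun x : ℝ => ((x - t : ℝ) : ℂ)) ((1 : ℝ) : ℂ) x :=
      ((hasDerivAt_id x).sub_const t).ofReal_comp
    have := (h1 x).sub (h3.mul_const (fd t))
    refine HasDerivAt.congr_deriv (f := fun x : ℝ => f x - ((x - t : ℝ) : ℂ) * fd t) this ?_
    simp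
  have := hconv.norm_image_sub_le_of_norm_hasDerivWithin_le
      (fun x _ => (hD x).hasDerivWithinAt) hA ht ((hmem s).2 hs)
  have e : f s - f t - (s - t : ℝ) * fd t
      = f s - ((s - t : ℝ) : ℂ) * fd t - (f t - ((t - t : ℝ) : ℂ) * fd t) := by
    simp; ring
  rw [e]
  refine this.trans ?_
  have h4 : ‖s - t‖ ≤ r := hs
  calc M * r * ‖s - t‖ ≤ M * r * r := mul_le_mul_of_nonneg_left h4 (by positivity)
    _ = M * r ^ 2 := by ring

lemma th_summable_exp (y c : ℝ) (hy : 0 < y) :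
    HasSum (fun n : ℕ => Real.exp (-(2 * Real.pi * (y * (n + 1 + c)))))
      (Real.exp (-(2 * Real.pi * (y * (1 + c)))) * (1 - Real.exp (-(2 * Real.pi * y)))⁻¹) := by
  have h1 : Real.exp (-(2 * Real.pi * y)) < 1 := by
    rw [Real.exp_lt_one_iff]
    have := Real.pi_pos
    have : 0 < 2 * Real.pi * y := by positivity
    linarith
  have := (hasSum_geometric_of_lt_one (Real.exp_pos _).le h1).mul_left
    (Real.exp (-(2 * Real.pi * (y * (1 + c)))))
  refine Eq.subst (motive := fun F : ℕ → ℝ => HasSum F _) (funext fun n => ?_) this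
  symm
  rw [← Real.exp_nat_mul, ← Real.exp_add]
  congr 1
  ring

lemma th_summable_wE (w : ℂ) (y c : ℝ) (hy : 0 < y) :
    Summable (fun n : ℕ => -(w * thE (y * (n + 1 + c)))) := by
  have := (th_summable_exp y c hy).summable
  have h2 : Summable (fun n : ℕ => thE (y * (n + 1 + c))) := by
    unfold thE
    exact_mod_cast this
  exact (h2.mul_left w).neg

lemma th_summable_L (w : ℂ) (y c : ℝ) (hy : 0 < y) :
    Summable (fun n : ℕ => thL w (y * (n + 1 + c))) := by
  have := Complex.summable_log_one_add_of_summable (th_summable_wE w y c hy)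
  simpa only [thL, sub_eq_add_neg] using this

noncomputable def thS (w : ℂ) (c y : ℝ) : ℂ := ∑' n : ℕ, thL w (y * (n + 1 + c))

lemma th_exp_S (w : ℂ) (hw : ‖w‖ = 1) (hw1 : w ≠ 1) (y c : ℝ) (hy : 0 < y) :
    Complex.exp (thS w c y) = ∏' n : ℕ, (1 - w * thE (y * (n + 1 + c))) :=
  Complex.cexp_tsum_eq_tprod (fun n => Complex.slitPlane_ne_zero (th_slit w hw hw1 _))
    (th_summable_L w y c hy)

lemma th_mult (w : ℂ) (y c : ℝ) (hy : 0 < y) :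
    Multipliable (fun n : ℕ => (1 - w * thE (y * (n + 1 + c)))) :=
  Complex.multipliable_of_summable_log (th_summable_L w y c hy)

lemma thS_one (w : ℂ) (y : ℝ) (hy : 0 < y) :
    thS w 1 y = thS w 0 y - thL w y := by
  have := (th_summable_L w y 0 hy).tsum_eq_zero_add
  unfold thS
  rw [this]
  simp

lemma thS_est (w : ℂ) (hw : ‖w‖ = 1) (hw1 : w ≠ 1) (c : ℝ) :
    ∃ K : ℝ, ∀ y : ℝ, 0 < y → y < 1 →
      ‖thS w c y - thS w 0 y + c * thL w y‖ ≤ K * y := by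
  have hpi := Real.pi_pos
  have hre := th_re_lt w hw hw1
  set R : ℝ := |c| + 1 with hR
  have hR0 : 0 < R := by positivity
  set C : ℝ := (2 * Real.pi) ^ 2 / ((1 - w.re) / 2) with hC
  have hC0 : 0 < C := by
    have : 0 < 1 - w.re := by linarith
    positivity
  refine ⟨C * Real.exp (2 * Real.pi * R) * R ^ 2 * R * ((1 + 2 * Real.pi) / (2 * Real.pi)), ?_⟩
  intro y hy hy1
  have key : ∀ n : ℕ, ‖thL w (y * (n + 1 + c)) - thL w (y * (n + 1 + 0))
      - c * (thL w (y * (n + 1 + 1)) - thL w (y * (n + 1 + 0)))‖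
      ≤ (C * Real.exp (2 * Real.pi * R) * R ^ 2 * R * y ^ 2) *
        Real.exp (-(2 * Real.pi * (y * (n + 1 + 0)))) := by
    intro n
    set t : ℝ := y * (n + 1 + 0) with ht
    set M : ℝ := C * Real.exp (2 * Real.pi * R) * Real.exp (-(2 * Real.pi * t)) with hM
    have hM0 : 0 ≤ M := by positivity
    have hb : ∀ s, |s - t| ≤ y * R →
        ‖-(2 * Real.pi : ℂ) ^ 2 * (w * thE s) / (1 - w * thE s) ^ 2‖ ≤ M := by
      intro s hs
      refine (thL_bound2 w hw hw1 s).trans ?_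
      rw [hM, mul_assoc C, ← Real.exp_add]
      apply mul_le_mul_of_nonneg_left _ hC0.le
      apply Real.exp_le_exp.2
      have h1 : t - s ≤ R := by
        have := (abs_le.1 hs).1
        nlinarith
      nlinarith
    have T := th_taylor (thL w) _ _ (thL_hasDeriv w hw hw1) (thL_hasDeriv2 w hw hw1) t (y * R) M
      hM0 hb
    have T1 := T (y * (n + 1 + c)) (by
      have : y * (n + 1 + c) - t = y * c := by rw [ht]; ring
      rw [this, abs_mul, abs_of_pos hy]
      apply mul_le_mul_of_nonneg_left _ hy.le
      linarith)
    have T2 := T (y * (n + 1 + 1)) (by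
      have : y * (n + 1 + 1) - t = y := by rw [ht]; ring
      rw [this, abs_of_pos hy]
      have : 0 ≤ |c| := abs_nonneg c
      nlinarith)
    have e1 : y * (n + 1 + c) - t = y * c := by rw [ht]; ring
    have e2 : y * (n + 1 + 1) - t = y := by rw [ht]; ring
    rw [e1] at T1
    rw [e2] at T2
    generalize 2 * (Real.pi : ℂ) * (w * thE t) / (1 - w * thE t) = D at T1 T2
    have e3 : thL w (y * (n + 1 + c)) - thL w t - c * (thL w (y * (n + 1 + 1)) - thL w t)
      = (thL w (y * (n + 1 + c)) - thL w t - (y * c : ℝ) * D)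
        - c * (thL w (y * (n + 1 + 1)) - thL w t - (y : ℝ) * D) := by
      push_cast; ring
    rw [e3]
    refine (norm_sub_le _ _).trans ?_
    rw [norm_mul, Complex.norm_real, Real.norm_eq_abs]
    calc _ ≤ M * (y * R) ^ 2 + |c| * (M * (y * R) ^ 2) :=
          add_le_add T1 (mul_le_mul_of_nonneg_left T2 (abs_nonneg c))
      _ = _ := by rw [hM, hR]; ring
  have hsum := (th_summable_exp y 0 hy).mul_left
    (C * Real.exp (2 * Real.pi * R) * R ^ 2 * R * y ^ 2)
  have B := tsum_of_norm_bounded hsum key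
  have s0 := th_summable_L w y 0 hy
  have s1 := th_summable_L w y 1 hy
  have sc := th_summable_L w y c hy
  rw [(sc.sub s0).tsum_sub ((s1.sub s0).mul_left _), sc.tsum_sub s0, tsum_mul_left,
    s1.tsum_sub s0] at B
  change ‖thS w c y - thS w 0 y - c * (thS w 1 y - thS w 0 y)‖ ≤ _ at B
  rw [thS_one w y hy] at B
  have e : thS w c y - thS w 0 y - c * (thS w 0 y - thL w y - thS w 0 y)
    = thS w c y - thS w 0 y + c * thL w y := by ring
  rw [e] at B
  refine B.trans ?_
  have hx : 0 < 2 * Real.pi * y := by positivity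
  have hq : 2 * Real.pi * y / (1 + 2 * Real.pi * y) ≤ 1 - Real.exp (-(2 * Real.pi * y)) := by
    rw [Real.exp_neg]
    have h1 := Real.add_one_le_exp (2 * Real.pi * y)
    have h2 : (Real.exp (2 * Real.pi * y))⁻¹ ≤ (1 + 2 * Real.pi * y)⁻¹ :=
      inv_anti₀ (by positivity) (by linarith)
    have h3 : 2 * Real.pi * y / (1 + 2 * Real.pi * y) = 1 - (1 + 2 * Real.pi * y)⁻¹ := by
      field_simp; ring
    rw [h3]; linarith
  have hq2 : (1 - Real.exp (-(2 * Real.pi * y)))⁻¹ ≤ (1 + 2 * Real.pi) / (2 * Real.pi * y) := by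
    have h4 := inv_anti₀ (by positivity) hq
    rw [inv_div] at h4
    refine h4.trans ?_
    apply div_le_div_of_nonneg_right _ hx.le
    nlinarith
  have hq3 : Real.exp (-(2 * Real.pi * (y * (1 + 0)))) ≤ 1 := by
    apply Real.exp_le_one_iff.2
    rw [add_zero, mul_one]; linarith
  have hq4 : 0 ≤ (1 - Real.exp (-(2 * Real.pi * y)))⁻¹ :=
    inv_nonneg.2 (le_trans (by positivity) hq)
  calc _ ≤ C * Real.exp (2 * Real.pi * R) * R ^ 2 * R * y ^ 2 *
        (1 * ((1 + 2 * Real.pi) / (2 * Real.pi * y))) := by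
        apply mul_le_mul_of_nonneg_left _ (by positivity)
        exact mul_le_mul hq3 hq2 hq4 zero_le_one
    _ = _ := by field_simp

lemma thS_tendsto (w : ℂ) (hw : ‖w‖ = 1) (hw1 : w ≠ 1) (c : ℝ) :
    Filter.Tendsto (fun y : ℝ => thS w c y - thS w 0 y) (nhdsWithin 0 (Set.Ioi 0))
      (nhds (-(c * Complex.log (1 - w)))) := by
  obtain ⟨K, hK⟩ := thS_est w hw hw1 c
  have h1 : Filter.Tendsto (fun y : ℝ => thS w c y - thS w 0 y + c * thL w y)
      (nhdsWithin 0 (Set.Ioi 0)) (nhds 0) := by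
    apply squeeze_zero_norm' (a := fun y => K * y)
    · filter_upwards [Ioo_mem_nhdsGT (zero_lt_one' ℝ)] with y hy
      exact hK y hy.1 hy.2
    · have : Filter.Tendsto (fun y : ℝ => K * y) (nhds 0) (nhds (K * 0)) :=
        (continuous_const.mul continuous_id).tendsto 0
      rw [mul_zero] at this
      exact this.mono_left nhdsWithin_le_nhds
  have h2 : Filter.Tendsto (fun y : ℝ => thL w y) (nhdsWithin 0 (Set.Ioi 0))
      (nhds (Complex.log (1 - w))) := by
    have := (thL_hasDeriv w hw hw1 0).continuousAt.tendsto
    have e : thL w 0 = Complex.log (1 - w) := by simp [thL, thE]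
    rw [e] at this
    exact this.mono_left nhdsWithin_le_nhds
  have := h1.sub (h2.const_mul (c : ℂ))
  simpa using this

lemma th_theta (z a y : ℝ) (hz : z ∈ Set.Ioo (0 : ℝ) 1) (hy : 0 < y) (u v : ℂ)
    (hu : u = Complex.exp (2 * Real.pi * Complex.I * z))
    (hv : v = Complex.exp (-(2 * Real.pi * Complex.I * z)))
    (hu0 : ‖u‖ = 1) (hv0 : ‖v‖ = 1) (hu1 : u ≠ 1) (hv1 : v ≠ 1) :
    oddJacobiTheta ((z : ℂ) + Complex.I * (y : ℂ) * (a : ℂ))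
      ((Real.exp (-(2 * Real.pi * y)) : ℝ) : ℂ) =
    (Complex.exp (Real.pi * Complex.I * ((z : ℂ) + Complex.I * (y : ℂ) * (a : ℂ))) -
      Complex.exp (-(Real.pi * Complex.I * ((z : ℂ) + Complex.I * (y : ℂ) * (a : ℂ))))) *
     (Complex.exp (thS u a y) * Complex.exp (thS v (-a) y)) := by
  rw [th_exp_S u hu0 hu1 y a hy, th_exp_S v hv0 hv1 y (-a) hy,
    ← (th_mult u y a hy).tprod_mul (th_mult v y (-a) hy)]
  unfold oddJacobiTheta
  congr 1
  apply tprod_congr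
  intro n
  have hI : Complex.I * Complex.I = -1 := Complex.I_mul_I
  congr 2
  · rw [hu, thE, Complex.ofReal_exp, Complex.ofReal_exp, ← Complex.exp_nat_mul,
      ← Complex.exp_add, ← Complex.exp_add]
    congr 1
    push_cast
    linear_combination (2 * Real.pi * y * a : ℂ) * hI
  · rw [hv, thE, Complex.ofReal_exp, Complex.ofReal_exp, ← Complex.exp_nat_mul,
      ← Complex.exp_add, ← Complex.exp_add]
    congr 1
    push_cast
    linear_combination -(2 * Real.pi * y * a : ℂ) * hI

lemma th_log (z : ℝ) (hz : z ∈ Set.Ioo (0 : ℝ) 1) :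
    Complex.log (1 - Complex.exp (2 * Real.pi * Complex.I * z))
      = Real.log (2 * Real.sin (Real.pi * z)) + (Real.pi * z - Real.pi / 2) * Complex.I ∧
    Complex.log (1 - Complex.exp (-(2 * Real.pi * Complex.I * z)))
      = Real.log (2 * Real.sin (Real.pi * z)) - (Real.pi * z - Real.pi / 2) * Complex.I := by
  have hpi := Real.pi_pos
  obtain ⟨h0, h1⟩ := hz
  have hs : 0 < 2 * Real.sin (Real.pi * z) := by
    have := Real.sin_pos_of_pos_of_lt_pi (x := Real.pi * z) (by positivity) (by nlinarith)
    linarith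
  have hE : ∀ X : ℂ, Complex.exp (X * Complex.I - Real.pi / 2 * Complex.I) =
      -Complex.I * Complex.exp (X * Complex.I) := by
    intro X
    rw [Complex.exp_sub, Complex.exp_pi_div_two_mul_I]
    field_simp
    simp
  have hE2 : ∀ X : ℂ, Complex.exp (X * Complex.I + Real.pi / 2 * Complex.I) =
      Complex.I * Complex.exp (X * Complex.I) := by
    intro X
    rw [Complex.exp_add, Complex.exp_pi_div_two_mul_I]
    ring
  have hI : Complex.I * Complex.I = -1 := Complex.I_mul_I
  have hmul : Complex.exp ((Real.pi * z : ℂ) * Complex.I) *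
      Complex.exp (-(Real.pi * z : ℂ) * Complex.I) = 1 := by
    rw [← Complex.exp_add]; simp
  constructor
  · have e : 1 - Complex.exp (2 * Real.pi * Complex.I * z)
      = ((2 * Real.sin (Real.pi * z) : ℝ) : ℂ) *
        Complex.exp ((Real.pi * z - Real.pi / 2) * Complex.I) := by
      have e1 : Complex.exp (2 * Real.pi * Complex.I * z) =
        Complex.exp ((Real.pi * z : ℂ) * Complex.I) * Complex.exp ((Real.pi * z : ℂ) * Complex.I) := by
        rw [← Complex.exp_add]; ring_nf
      rw [sub_mul, hE, e1]
      push_cast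
      rw [Complex.sin]
      linear_combination -hmul + (Complex.exp (-(Real.pi * z : ℂ) * Complex.I) -
        Complex.exp ((Real.pi * z : ℂ) * Complex.I)) * Complex.exp ((Real.pi * z : ℂ) * Complex.I) * hI
    rw [e, Complex.log_ofReal_mul hs (Complex.exp_ne_zero _), Complex.log_exp]
    · simp; nlinarith
    · simp; nlinarith
  · have e : 1 - Complex.exp (-(2 * Real.pi * Complex.I * z))
      = ((2 * Real.sin (Real.pi * z) : ℝ) : ℂ) *
        Complex.exp (-(Real.pi * z) * Complex.I + Real.pi / 2 * Complex.I) := by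
      have e1 : Complex.exp (-(2 * Real.pi * Complex.I * z)) =
        Complex.exp (-(Real.pi * z : ℂ) * Complex.I) *
          Complex.exp (-(Real.pi * z : ℂ) * Complex.I) := by
        rw [← Complex.exp_add]; ring_nf
      rw [hE2, e1]
      push_cast
      rw [Complex.sin]
      linear_combination -hmul - (Complex.exp (-(Real.pi * z : ℂ) * Complex.I) -
        Complex.exp ((Real.pi * z : ℂ) * Complex.I)) * Complex.exp (-(Real.pi * z : ℂ) * Complex.I) * hI
    rw [e, Complex.log_ofReal_mul hs (Complex.exp_ne_zero _), Complex.log_exp]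
    · ring
    · simp; nlinarith
    · simp; nlinarith

lemma th_single (z a b : ℝ) (hz : z ∈ Set.Ioo (0 : ℝ) 1) :
    Filter.Tendsto
      (fun y : ℝ => oddJacobiTheta ((z : ℂ) + Complex.I * (y : ℂ) * (a : ℂ))
              ((Real.exp (-(2 * Real.pi * y)) : ℝ) : ℂ) /
            oddJacobiTheta ((z : ℂ) + Complex.I * (y : ℂ) * (b : ℂ))
              ((Real.exp (-(2 * Real.pi * y)) : ℝ) : ℂ))
      (nhdsWithin 0 (Set.Ioi 0))
      (nhds (Complex.exp (Real.pi * Complex.I * ((a - b : ℝ) : ℂ) * (1 - 2 * z)))) := by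
  have hpi := Real.pi_pos
  obtain ⟨hl1, hl2⟩ := th_log z hz
  have hs : 0 < Real.sin (Real.pi * z) :=
    Real.sin_pos_of_pos_of_lt_pi (mul_pos hpi hz.1) (by nlinarith [hz.2])
  set P : ℝ → ℝ → ℂ := fun c y =>
    Complex.exp (Real.pi * Complex.I * ((z : ℂ) + Complex.I * (y : ℂ) * (c : ℂ))) -
      Complex.exp (-(Real.pi * Complex.I * ((z : ℂ) + Complex.I * (y : ℂ) * (c : ℂ)))) with hP
  set p : ℂ := Complex.exp (Real.pi * Complex.I * z) - Complex.exp (-(Real.pi * Complex.I * z))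
    with hp
  have hp0 : p ≠ 0 := by
    have : p = 2 * Complex.I * ((Real.sin (Real.pi * z) : ℝ) : ℂ) := by
      push_cast
      rw [Complex.sin, hp]
      have a1 : (Real.pi * z : ℂ) * Complex.I = Real.pi * Complex.I * z := by ring
      have a2 : -(Real.pi * z : ℂ) * Complex.I = -(Real.pi * Complex.I * z) := by ring
      rw [a1, a2]
      linear_combination -(Complex.exp (-(Real.pi * Complex.I * z)) -
        Complex.exp (Real.pi * Complex.I * z)) * Complex.I_mul_I
    rw [this]
    simp only [ne_eq, mul_eq_zero, Complex.ofReal_eq_zero, Complex.I_ne_zero, hs.ne',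
      OfNat.ofNat_ne_zero, or_self, not_false_eq_true]
  have hPt : ∀ c, Filter.Tendsto (P c) (nhdsWithin 0 (Set.Ioi 0)) (nhds p) := by
    intro c
    have hc : Continuous (P c) := by rw [hP]; fun_prop
    have := hc.tendsto 0
    have e : P c 0 = p := by simp [hP, hp]
    rw [e] at this
    exact this.mono_left nhdsWithin_le_nhds
  set u : ℂ := Complex.exp (2 * Real.pi * Complex.I * z) with hu
  set v : ℂ := Complex.exp (-(2 * Real.pi * Complex.I * z)) with hv
  have huv : u * v = 1 := by rw [hu, hv, ← Complex.exp_add]; simp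
  have hu0 : ‖u‖ = 1 := by
    rw [hu, Complex.norm_exp]; simp
  have hv0 : ‖v‖ = 1 := by
    rw [hv, Complex.norm_exp]; simp
  have hu1 : u ≠ 1 := by
    intro h
    have : u - 1 = p * Complex.exp (Real.pi * Complex.I * z) := by
      rw [hp, hu, sub_mul, ← Complex.exp_add, ← Complex.exp_add]
      ring_nf; simp; ring
    rw [h, sub_self] at this
    exact mul_ne_zero hp0 (Complex.exp_ne_zero _) this.symm
  have hv1 : v ≠ 1 := by
    intro h; rw [h, mul_one] at huv; exact hu1 huv
  have key : ∀ c, Filter.Tendsto (fun y : ℝ => P c y * (Complex.exp (thS u c y - thS u 0 y) *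
      Complex.exp (thS v (-c) y - thS v 0 y))) (nhdsWithin 0 (Set.Ioi 0))
      (nhds (p * (Complex.exp (-(c * Complex.log (1 - u))) *
        Complex.exp (-((-c : ℝ) * Complex.log (1 - v)))))) := by
    intro c
    exact (hPt c).mul (((Complex.continuous_exp.tendsto _).comp (thS_tendsto u hu0 hu1 c)).mul
      ((Complex.continuous_exp.tendsto _).comp (thS_tendsto v hv0 hv1 (-c))))
  have hq := (key a).div (key b)
    (mul_ne_zero hp0 (mul_ne_zero (Complex.exp_ne_zero _) (Complex.exp_ne_zero _)))
  have hlim : p * (Complex.exp (-(a * Complex.log (1 - u))) *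
        Complex.exp (-((-a : ℝ) * Complex.log (1 - v)))) /
      (p * (Complex.exp (-(b * Complex.log (1 - u))) *
        Complex.exp (-((-b : ℝ) * Complex.log (1 - v))))) =
      Complex.exp (Real.pi * Complex.I * ((a - b : ℝ) : ℂ) * (1 - 2 * z)) := by
    rw [mul_div_mul_left _ _ hp0, ← Complex.exp_add, ← Complex.exp_add, ← Complex.exp_sub,
      hl1, hl2]
    congr 1
    push_cast
    ring
  rw [hlim] at hq
  refine hq.congr' ?_
  filter_upwards [self_mem_nhdsWithin] with y hy
  have hy : 0 < y := hy
  rw [th_theta z a y hz hy u v hu hv hu0 hv0 hu1 hv1,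
    th_theta z b y hz hy u v hu hv hu0 hv0 hu1 hv1]
  change P a y * _ / (P b y * _) = P a y * _ / (P b y * _)
  simp only [Complex.exp_sub]
  have q1 := Complex.exp_ne_zero (thS u 0 y)
  have q2 := Complex.exp_ne_zero (thS v 0 y)
  have q3 := Complex.exp_ne_zero (thS u b y)
  have q4 := Complex.exp_ne_zero (thS v (-b) y)
  by_cases hPb : P b y = 0
  · simp [hPb]
  · field_simp

/-- The `τ → 0` side of the modular-duality limit identity for ratios of odd
Jacobi theta functions: with `τ = iy`, `y → 0⁺`, and nome `e^{2πiτ} = e^{−2πy}`,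
`lim_{y→0⁺} e^{2πi∑(aⱼ−bⱼ)zⱼ} ∏ⱼ ϑ(zⱼ + iy aⱼ; e^{−2πy})/ϑ(zⱼ + iy bⱼ; e^{−2πy})
  = e^{πi∑(aⱼ−bⱼ)}`. -/
theorem tau_to_zero_limit_of_theta_ratio
    (g : ℕ) (hg : 1 ≤ g) (z a b : Fin g → ℝ)
    (hz : ∀ j, z j ∈ Set.Ioo (0 : ℝ) 1) :
    Filter.Tendsto
      (fun y : ℝ =>
        Complex.exp (2 * Real.pi * Complex.I * ∑ j, ((a j - b j : ℝ) : ℂ) * (z j : ℂ)) *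
          ∏ j, oddJacobiTheta ((z j : ℂ) + Complex.I * (y : ℂ) * (a j : ℂ))
              ((Real.exp (-(2 * Real.pi * y)) : ℝ) : ℂ) /
            oddJacobiTheta ((z j : ℂ) + Complex.I * (y : ℂ) * (b j : ℂ))
              ((Real.exp (-(2 * Real.pi * y)) : ℝ) : ℂ))
      (nhdsWithin 0 (Set.Ioi 0))
      (nhds (Complex.exp (Real.pi * Complex.I * ∑ j, ((a j - b j : ℝ) : ℂ)))) := by
  have h := tendsto_finsetProd (Finset.univ : Finset (Fin g))
    (fun j _ => th_single (z j) (a j) (b j) (hz j))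
  have h2 := h.const_mul
    (Complex.exp (2 * Real.pi * Complex.I * ∑ j, ((a j - b j : ℝ) : ℂ) * (z j : ℂ)))
  convert h2 using 2
  rw [← Complex.exp_sum, ← Complex.exp_add]
  congr 1
  rw [Finset.mul_sum, Finset.mul_sum, ← Finset.sum_add_distrib]
  apply Finset.sum_congr rfl
  intro j _
  ring
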